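/- Let L be a finite nonempty set, let ℓ > 0 and 0 < δ < 1/2 be reals, and let f : L → ℝ satisfy (1−δ)·ℓ ≤ f(u) ≤ (1+δ)·ℓ for every u ∈ L. Let D be the distribution on L with D(u) = f(u)/(Σ_{v∈L} f(v)), let E be an arbitrary probability distribution on L, and let 0 ≤ η ≤ δ/(1−δ). Then the convex combination (1−η)·D + η·E is (3δ/(1−δ))-close to the uniform distribution on L. -/

import Mathlib

open Finset

/-- If all values of `f` lie within `δℓ` of `ℓ`, then normalizing `f` gives masses within
`2δ/(1−δ)` of uniform, relative to the uniform mass. -/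
theorem abs_div_sum_sub_one_div_card_le {L : Type*} [Fintype L] [Nonempty L]
    {ℓ δ : ℝ} (hℓ : 0 < ℓ) (hδ0 : 0 ≤ δ) (hδ1 : δ < 1)
    {f : L → ℝ} (hf : ∀ u, (1 - δ) * ℓ ≤ f u ∧ f u ≤ (1 + δ) * ℓ) (u : L) :
    |f u / (∑ v, f v) - 1 / (Fintype.card L : ℝ)| ≤
      2 * (δ / (1 - δ)) * (1 / (Fintype.card L : ℝ)) := by
  have hn : (0 : ℝ) < Fintype.card L := by exact_mod_cast Fintype.card_pos
  have hδ : 0 < 1 - δ := by linarith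
  have hlow : Fintype.card L * ((1 - δ) * ℓ) ≤ ∑ v, f v := by
    simpa using Finset.sum_le_sum fun v (_ : v ∈ univ) => (hf v).1
  have hupp : ∑ v, f v ≤ Fintype.card L * ((1 + δ) * ℓ) := by
    simpa using Finset.sum_le_sum fun v (_ : v ∈ univ) => (hf v).2
  generalize ∑ v, f v = S at *
  generalize (Fintype.card L : ℝ) = n at *
  have hS : 0 < S := lt_of_lt_of_le (by positivity) hlow
  have hnum : |n * f u - S| ≤ 2 * (δ / (1 - δ)) * S := by
    have h1 := mul_le_mul_of_nonneg_left (hf u).1 hn.le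
    have h2 := mul_le_mul_of_nonneg_left (hf u).2 hn.le
    calc |n * f u - S| ≤ 2 * (δ / (1 - δ)) * (n * ((1 - δ) * ℓ)) := by
          have h3 : 2 * (δ / (1 - δ)) * (n * ((1 - δ) * ℓ)) = 2 * n * δ * ℓ := by
            field_simp
          rw [h3, abs_le]
          constructor <;> linarith
      _ ≤ _ := by gcongr
  have heq : f u / S - 1 / n = (n * f u - S) / (n * S) := by field_simp
  rw [heq, abs_div, abs_of_pos (mul_pos hn hS), div_le_iff₀ (mul_pos hn hS)]
  calc |n * f u - S| ≤ 2 * (δ / (1 - δ)) * S := hnum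
    _ = _ := by field_simp

/-- The convex combination `(1−η)·D + η·E`, where `D(u) = f(u)/∑ f` with `f` having
values within `δℓ` of `ℓ` and `η ≤ δ/(1−δ)`, is `(3δ/(1−δ))`-close to uniform on `L`. -/
theorem stmt_6 {L : Type*} [Fintype L] [Nonempty L]
    (ℓ δ η : ℝ) (hℓ : 0 < ℓ) (hδ0 : 0 < δ) (hδ1 : δ < 1 / 2)
    (f : L → ℝ) (hf : ∀ u, (1 - δ) * ℓ ≤ f u ∧ f u ≤ (1 + δ) * ℓ)
    (E : L → ℝ) (hE0 : ∀ u, 0 ≤ E u) (hE1 : ∑ u, E u = 1)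
    (hη0 : 0 ≤ η) (hη1 : η ≤ δ / (1 - δ)) :
    (1 / 2) * ∑ u, |((1 - η) * (f u / (∑ v, f v)) + η * E u) - 1 / (Fintype.card L : ℝ)| ≤
      3 * δ / (1 - δ) := by
  have hn : (0 : ℝ) < Fintype.card L := by exact_mod_cast Fintype.card_pos
  have hδ : 0 < 1 - δ := by linarith
  have hη : η ≤ 1 := hη1.trans ((div_le_one hδ).2 (by linarith))
  have hc : 0 ≤ δ / (1 - δ) := by positivity
  have key : ∀ u, |((1 - η) * (f u / (∑ v, f v)) + η * E u) - 1 / (Fintype.card L : ℝ)| ≤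
      2 * (δ / (1 - δ)) * (1 / (Fintype.card L : ℝ)) +
        η * (E u + 1 / (Fintype.card L : ℝ)) := by
    intro u
    have hD := abs_div_sum_sub_one_div_card_le hℓ hδ0.le (by linarith) hf u
    have hE : |E u - 1 / (Fintype.card L : ℝ)| ≤ E u + 1 / (Fintype.card L : ℝ) := by
      have := hE0 u
      have : 0 < 1 / (Fintype.card L : ℝ) := by positivity
      rw [abs_le]
      constructor <;> linarith
    calc _ = |(1 - η) * (f u / (∑ v, f v) - 1 / (Fintype.card L : ℝ)) +
          η * (E u - 1 / (Fintype.card L : ℝ))| := by congr 1; ring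
      _ ≤ (1 - η) * |f u / (∑ v, f v) - 1 / (Fintype.card L : ℝ)| +
          η * |E u - 1 / (Fintype.card L : ℝ)| := by
        refine (abs_add_le _ _).trans_eq ?_
        rw [abs_mul, abs_mul, abs_of_nonneg (sub_nonneg.2 hη), abs_of_nonneg hη0]
      _ ≤ _ := by
        exact add_le_add
          ((mul_le_of_le_one_left (abs_nonneg _) (sub_le_self 1 hη0)).trans hD)
          (mul_le_mul_of_nonneg_left hE hη0)
  have hsum := Finset.sum_le_sum fun u (_ : u ∈ univ) => key u
  have hone : (Fintype.card L : ℝ) * (1 / (Fintype.card L : ℝ)) = 1 :=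
    mul_one_div_cancel hn.ne'
  have htot : ∑ u, (2 * (δ / (1 - δ)) * (1 / (Fintype.card L : ℝ)) +
      η * (E u + 1 / (Fintype.card L : ℝ))) = 2 * (δ / (1 - δ)) + 2 * η := by
    rw [sum_add_distrib, ← mul_sum, ← mul_sum, sum_add_distrib, hE1, sum_const, card_univ,
      nsmul_eq_mul, hone]
    ring
  rw [htot] at hsum
  rw [mul_div_assoc]
  linarith
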